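/- Let ε, μ : ℝ³ → ℝ be C² up to the boundary of Π with ε > 0 and μ > 0 on the closure of Π. Let v, f : ℝ³ → ℂ³ be C² up to the boundary, with v of compact axial support, div(μv) = 0 on Π, and ⟨v, ν⟩ = ⟨f, ν⟩ = 0 on ∂Π. Then ∫_Π ε⁻¹·⟨curl v, curl f⟩ dx = ∫_Π Σⱼ ⟨∂ⱼ(μ^{1/2}v), ∂ⱼ(ε⁻¹μ^{−1/2}f)⟩ dx − ∫_Π ⟨curl v, μ·[∇((εμ)⁻¹), f]⟩ dx + ∫_Π ε⁻¹·⟨W(μ)v, f⟩ dx + ∫_{∂Π} ⟨(ε⁻¹R⁻¹·P − (2εμ)⁻¹·(∂_νμ)·I₃)·v, f⟩ dS, where P = diag(1, 1, 0), I₃ is the 3×3 identity matrix and ∂_νμ = ⟨∇μ, ν⟩. -/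

import Mathlib

noncomputable section

open MeasureTheory Real Complex

/-- Points of `ℝ³`. -/
abbrev V3 := Fin 3 → ℝ
/-- Vectors of `ℂ³`. -/
abbrev C3 := Fin 3 → ℂ

/-- Partial derivative `∂ⱼ` of a complex scalar function on `ℝ³`. -/
def pd (j : Fin 3) (f : V3 → ℂ) (x : V3) : ℂ := fderiv ℝ f x (Pi.single j 1)

/-- Partial derivative `∂ⱼ` of a real scalar function on `ℝ³`. -/
def pdR (j : Fin 3) (f : V3 → ℝ) (x : V3) : ℝ := fderiv ℝ f x (Pi.single j 1)

/-- Partial derivative `∂ⱼ` of a vector field, taken componentwise. -/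
def pdV (j : Fin 3) (a : V3 → C3) (x : V3) : C3 := fun i => pd j (fun y => a y i) x

/-- curl a = (∂₂a₃ − ∂₃a₂, ∂₃a₁ − ∂₁a₃, ∂₁a₂ − ∂₂a₁)  (indices 0,1,2). -/
def vcurl (a : V3 → C3) (x : V3) : C3 :=
  ![pd 1 (fun y => a y 2) x - pd 2 (fun y => a y 1) x,
    pd 2 (fun y => a y 0) x - pd 0 (fun y => a y 2) x,
    pd 0 (fun y => a y 1) x - pd 1 (fun y => a y 0) x]

/-- div a = ∂₁a₁ + ∂₂a₂ + ∂₃a₃. -/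
def vdiv (a : V3 → C3) (x : V3) : ℂ := ∑ j, pd j (fun y => a y j) x

/-- The bilinear (unconjugated) cross product on ℂ³. -/
def cross (a b : C3) : C3 :=
  ![a 1 * b 2 - a 2 * b 1, a 2 * b 0 - a 0 * b 2, a 0 * b 1 - a 1 * b 0]

/-- The Hermitian inner product ⟨a, b⟩ = Σⱼ aⱼ · conj(bⱼ). -/
def hinner (a b : C3) : ℂ := ∑ j, a j * (starRingEnd ℂ) (b j)

/-- The gradient of a real function, viewed as a complex vector. -/
def gradC (g : V3 → ℝ) (x : V3) : C3 := fun j => (pdR j g x : ℂ)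

/-- The Laplacian Δg = ∂₁²g + ∂₂²g + ∂₃²g of a real function. -/
def lapR (g : V3 → ℝ) (x : V3) : ℝ := ∑ j, pdR j (fun y => pdR j g y) x

/-- The solid infinite circular cylinder Π of radius `R`. -/
def Cyl (R : ℝ) : Set V3 := {x | x 0 ^ 2 + x 1 ^ 2 < R ^ 2}

/-- The boundary ∂Π of the cylinder. -/
def bCyl (R : ℝ) : Set V3 := {x | x 0 ^ 2 + x 1 ^ 2 = R ^ 2}

/-- The outward unit normal of the cylinder at a boundary point. -/
def nuR (R : ℝ) (x : V3) : V3 := ![x 0 / R, x 1 / R, 0]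

/-- The outward unit normal, viewed as a complex vector. -/
def nuC (R : ℝ) (x : V3) : C3 := fun j => (nuR R x j : ℂ)

/-- The normal component ⟨z, ν⟩ of z ∈ ℂ³ at a boundary point of the cylinder. -/
def ncomp (R : ℝ) (x : V3) (z : C3) : ℂ := ∑ k, z k * (nuR R x k : ℂ)

/-- The normal derivative ∂_ν g = ⟨∇g, ν⟩ of a real function at a boundary point. -/
def dnu (R : ℝ) (g : V3 → ℝ) (x : V3) : ℝ := ∑ k, pdR k g x * nuR R x k

/-- The surface integral ∫_{∂Π} F dS = ∫_ℝ ∫₀^{2π} F(R cos θ, R sin θ, t)·R dθ dt. -/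
def surfInt (R : ℝ) (F : V3 → ℂ) : ℂ :=
  ∫ t : ℝ, ∫ θ in (0:ℝ)..(2 * π), F ![R * Real.cos θ, R * Real.sin θ, t] * (R : ℂ)

/-- `f` is `C^k` up to the boundary of the open set `S`: it is `k` times continuously
differentiable on an open neighborhood of the closure of `S`. -/
def UpTo {E : Type*} [NormedAddCommGroup E] [NormedSpace ℝ E]
    (k : ℕ) (S : Set V3) (f : V3 → E) : Prop :=
  ∃ U : Set V3, IsOpen U ∧ closure S ⊆ U ∧ ContDiffOn ℝ k f U

/-- `f` has compact axial support: it vanishes whenever `|x₃| ≥ T` for some `T > 0`. -/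
def AxialSupp {E : Type*} [Zero E] (f : V3 → E) : Prop :=
  ∃ T > 0, ∀ x : V3, T ≤ |x 2| → f x = 0

/-- The matrix W₀(μ)ⱼₖ = μ⁻¹(Δμ)δⱼₖ + μ⁻²(∂ⱼμ)(∂ₖμ) − μ⁻¹∂ⱼ∂ₖμ. -/
def W0 (μ : V3 → ℝ) (x : V3) (j k : Fin 3) : ℝ :=
  (μ x)⁻¹ * lapR μ x * (if j = k then 1 else 0)
    + ((μ x) ^ 2)⁻¹ * pdR j μ x * pdR k μ x
    - (μ x)⁻¹ * pdR j (fun y => pdR k μ y) x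

/-- The matrix W(μ)ⱼₖ = ((2μ)⁻¹Δμ − (4μ²)⁻¹|∇μ|²)δⱼₖ + μ⁻²(∂ⱼμ)(∂ₖμ) − μ⁻¹∂ⱼ∂ₖμ. -/
def Wm (μ : V3 → ℝ) (x : V3) (j k : Fin 3) : ℝ :=
  ((2 * μ x)⁻¹ * lapR μ x - (4 * (μ x) ^ 2)⁻¹ * (∑ i, (pdR i μ x) ^ 2))
      * (if j = k then 1 else 0)
    + ((μ x) ^ 2)⁻¹ * pdR j μ x * pdR k μ x
    - (μ x)⁻¹ * pdR j (fun y => pdR k μ y) x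

/-- Divergence theorem on the disc. -/
theorem integral_disc_divergence {R : ℝ} (hR : 0 < R) {F G : ℝ × ℝ → ℂ}
    (hF : ContDiff ℝ 1 F) (hG : ContDiff ℝ 1 G) :
    ∫ p in {p : ℝ × ℝ | p.1 ^ 2 + p.2 ^ 2 < R ^ 2},
        (fderiv ℝ F p (1, 0) + fderiv ℝ G p (0, 1))
      = ∫ θ in (0:ℝ)..(2 * π), (F (R * Real.cos θ, R * Real.sin θ) * (Real.cos θ : ℂ)
          + G (R * Real.cos θ, R * Real.sin θ) * (Real.sin θ : ℂ)) * (R : ℂ) := by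
  set D : ℝ × ℝ → ℂ := fun p => fderiv ℝ F p (1, 0) + fderiv ℝ G p (0, 1) with hD
  set q : ℝ × ℝ → ℝ × ℝ := fun p => (p.1 * Real.cos p.2, p.1 * Real.sin p.2) with hq
  have hqs : ContDiff ℝ 1 q := by
    have h1 : ContDiff ℝ 1 (fun p : ℝ × ℝ => Real.cos p.2) := Real.contDiff_cos.comp contDiff_snd
    have h2 : ContDiff ℝ 1 (fun p : ℝ × ℝ => Real.sin p.2) := Real.contDiff_sin.comp contDiff_snd
    exact (contDiff_fst.mul h1).prodMk (contDiff_fst.mul h2)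
  have hcC : ContDiff ℝ 1 (fun p : ℝ × ℝ => ((Real.cos p.2 : ℝ) : ℂ)) :=
    Complex.ofRealCLM.contDiff.comp (Real.contDiff_cos.comp contDiff_snd)
  have hsC : ContDiff ℝ 1 (fun p : ℝ × ℝ => ((Real.sin p.2 : ℝ) : ℂ)) :=
    Complex.ofRealCLM.contDiff.comp (Real.contDiff_sin.comp contDiff_snd)
  have hrC : ContDiff ℝ 1 (fun p : ℝ × ℝ => (p.1 : ℂ)) :=
    Complex.ofRealCLM.contDiff.comp contDiff_fst
  have hFq := hF.comp hqs
  have hGq := hG.comp hqs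
  set f : ℝ × ℝ → ℂ := fun p => (F (q p) * (Real.cos p.2 : ℂ) + G (q p) * (Real.sin p.2 : ℂ)) *
    (p.1 : ℂ) with hf
  set g : ℝ × ℝ → ℂ := fun p => G (q p) * (Real.cos p.2 : ℂ) - F (q p) * (Real.sin p.2 : ℂ) with hg
  have hfs : ContDiff ℝ 1 f := ((hFq.mul hcC).add (hGq.mul hsC)).mul hrC
  have hgs : ContDiff ℝ 1 g := (hGq.mul hcC).sub (hFq.mul hsC)
  have hlin : ∀ (H : ℝ × ℝ → ℂ) (x : ℝ × ℝ) (a b : ℝ),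
      fderiv ℝ H x (a, b) = a * fderiv ℝ H x (1, 0) + b * fderiv ℝ H x (0, 1) := by
    intro H x a b
    have : (a, b) = a • ((1, 0) : ℝ × ℝ) + b • ((0, 1) : ℝ × ℝ) := by simp
    rw [this, map_add, map_smul, map_smul, Complex.real_smul, Complex.real_smul]
  have hslice1 : ∀ (H : ℝ × ℝ → ℂ), ContDiff ℝ 1 H → ∀ r θ : ℝ,
      HasDerivAt (fun s => H (s, θ)) (fderiv ℝ H (r, θ) (1, 0)) r := by
    intro H hH r θ
    exact ((hH.differentiable one_ne_zero).differentiableAt.hasFDerivAt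
      (x := (r, θ))).comp_hasDerivAt r ((hasDerivAt_id r).prodMk (hasDerivAt_const r θ))
  have hslice2 : ∀ (H : ℝ × ℝ → ℂ), ContDiff ℝ 1 H → ∀ r θ : ℝ,
      HasDerivAt (fun s => H (r, s)) (fderiv ℝ H (r, θ) (0, 1)) θ := by
    intro H hH r θ
    exact ((hH.differentiable one_ne_zero).differentiableAt.hasFDerivAt
      (x := (r, θ))).comp_hasDerivAt θ ((hasDerivAt_const θ r).prodMk (hasDerivAt_id θ))
  have hcosC : ∀ θ : ℝ, HasDerivAt (fun s : ℝ => ((Real.cos s : ℝ) : ℂ))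
      ((-Real.sin θ : ℝ) : ℂ) θ := fun θ => (Real.hasDerivAt_cos θ).ofReal_comp
  have hsinC : ∀ θ : ℝ, HasDerivAt (fun s : ℝ => ((Real.sin s : ℝ) : ℂ))
      ((Real.cos θ : ℝ) : ℂ) θ := fun θ => (Real.hasDerivAt_sin θ).ofReal_comp
  have hr1 : ∀ (H : ℝ × ℝ → ℂ), ContDiff ℝ 1 H → ∀ r θ : ℝ,
      HasDerivAt (fun s => H (q (s, θ))) (Real.cos θ * fderiv ℝ H (q (r, θ)) (1, 0)
        + Real.sin θ * fderiv ℝ H (q (r, θ)) (0, 1)) r := by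
    intro H hH r θ
    rw [← hlin]
    refine ((hH.differentiable one_ne_zero).differentiableAt.hasFDerivAt
      (x := q (r, θ))).comp_hasDerivAt r ?_
    have := ((hasDerivAt_id r).mul_const (Real.cos θ)).prodMk
      ((hasDerivAt_id r).mul_const (Real.sin θ))
    simpa [hq] using this
  have hr2 : ∀ (H : ℝ × ℝ → ℂ), ContDiff ℝ 1 H → ∀ r θ : ℝ,
      HasDerivAt (fun s => H (q (r, s))) ((r * (-Real.sin θ) : ℝ) * fderiv ℝ H (q (r, θ)) (1, 0)
        + (r * Real.cos θ : ℝ) * fderiv ℝ H (q (r, θ)) (0, 1)) θ := by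
    intro H hH r θ
    rw [← hlin]
    refine ((hH.differentiable one_ne_zero).differentiableAt.hasFDerivAt
      (x := q (r, θ))).comp_hasDerivAt θ ?_
    exact ((Real.hasDerivAt_cos θ).const_mul r).prodMk ((Real.hasDerivAt_sin θ).const_mul r)
  have hpoint : ∀ x : ℝ × ℝ, fderiv ℝ f x (1, 0) + fderiv ℝ g x (0, 1) = x.1 • D (q x) := by
    rintro ⟨r, θ⟩
    have e1 := (hslice1 f hfs r θ).unique ((((hr1 F hF r θ).mul_const (Real.cos θ : ℂ)).add
      ((hr1 G hG r θ).mul_const (Real.sin θ : ℂ))).mul (hasDerivAt_id r).ofReal_comp)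
    have e2 := (hslice2 g hgs r θ).unique (((hr2 G hG r θ).mul (hcosC θ)).sub
      ((hr2 F hF r θ).mul (hsinC θ)))
    have hsc : ((Real.sin θ : ℝ) : ℂ) ^ 2 + ((Real.cos θ : ℝ) : ℂ) ^ 2 = 1 := by
      exact_mod_cast Real.sin_sq_add_cos_sq θ
    rw [e1, e2, Complex.real_smul, hD]
    simp only [Pi.add_apply, Complex.ofReal_mul, Complex.ofReal_neg, Complex.ofReal_one]
    linear_combination (r : ℂ) * (fderiv ℝ F (q (r, θ)) (1, 0) + fderiv ℝ G (q (r, θ)) (0, 1)) * hsc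
  have hDc : Continuous D :=
    ((hF.continuous_fderiv one_ne_zero).clm_apply continuous_const).add
      ((hG.continuous_fderiv one_ne_zero).clm_apply continuous_const)
  have hdiv := integral_divergence_prod_Icc_of_hasFDerivAt_of_le f g (fderiv ℝ f) (fderiv ℝ g)
    (0, -π) (R, π) ⟨hR.le, by simp [Real.pi_pos.le]⟩ hfs.continuous.continuousOn
    hgs.continuous.continuousOn
    (fun x _ => (hfs.differentiable one_ne_zero).differentiableAt.hasFDerivAt)
    (fun x _ => (hgs.differentiable one_ne_zero).differentiableAt.hasFDerivAt)
    (by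
      simp only [hpoint]
      exact (continuous_fst.smul (hDc.comp hqs.continuous)).continuousOn.integrableOn_compact
        isCompact_Icc)
  simp only [hpoint] at hdiv
  have hpol : ∫ p in {p : ℝ × ℝ | p.1 ^ 2 + p.2 ^ 2 < R ^ 2}, D p
      = ∫ p in Set.Icc ((0, -π) : ℝ × ℝ) (R, π), p.1 • D (q p) := by
    have hmd : MeasurableSet {p : ℝ × ℝ | p.1 ^ 2 + p.2 ^ 2 < R ^ 2} :=
      (isOpen_lt (by fun_prop) (by fun_prop)).measurableSet
    rw [← integral_indicator hmd, ← integral_comp_polarCoord_symm]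
    have hset : (Set.Ioo 0 R ×ˢ Set.Ioo (-π) π : Set (ℝ × ℝ)) =ᵐ[volume]
        Set.Icc ((0, -π) : ℝ × ℝ) (R, π) := by
      rw [← Set.Icc_prod_Icc]
      exact Measure.set_prod_ae_eq Ioo_ae_eq_Icc Ioo_ae_eq_Icc
    rw [← setIntegral_congr_set hset, ← integral_indicator polarCoord.open_target.measurableSet,
      ← integral_indicator (measurableSet_Ioo.prod measurableSet_Ioo)]
    congr 1
    ext ⟨r, θ⟩
    have hnorm : (r * Real.cos θ) ^ 2 + (r * Real.sin θ) ^ 2 = r ^ 2 := by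
      linear_combination r ^ 2 * Real.sin_sq_add_cos_sq θ
    by_cases hr : 0 < r
    · have : r ^ 2 < R ^ 2 ↔ r < R := by
        constructor
        · intro h; nlinarith
        · intro h; nlinarith
      simp only [Set.indicator_apply, polarCoord_target, Set.mem_prod, Set.mem_Ioi, Set.mem_Ioo,
        polarCoord_symm_apply, Set.mem_ofPred_eq, hnorm, this, hr, true_and, hq]
      by_cases h1 : r < R <;> by_cases h2 : -π < θ ∧ θ < π <;> simp [h1, h2]
    · simp [Set.indicator_apply, hr]
  rw [hpol, hdiv]
  have hg0 : ∀ r, g (r, π) = g (r, -π) := by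
    intro r; simp [hg, hq]
  simp only [hg0, sub_self, zero_add]
  have hf0 : ∀ θ, f (0, θ) = 0 := by intro θ; simp [hf]
  simp only [hf0, intervalIntegral.integral_zero, sub_zero]
  have hper : Function.Periodic (fun θ => f (R, θ)) (2 * π) := by
    intro θ; simp only [hf, hq, Real.cos_add_two_pi, Real.sin_add_two_pi]
  have := hper.intervalIntegral_add_eq (-π) 0
  rw [show -π + 2 * π = π by ring, zero_add] at this
  rw [this]

theorem integral_slice {g : V3 → ℂ} (hg : Integrable g) :
    (∫ x, g x = ∫ t : ℝ, ∫ p : ℝ × ℝ, g ![p.1, p.2, t]) ∧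
      (∫ x, g x = ∫ p : ℝ × ℝ, ∫ t : ℝ, g ![p.1, p.2, t]) := by
  let e : V3 ≃ᵐ ℝ × (ℝ × ℝ) := (MeasurableEquiv.piFinSuccAbove (fun _ => ℝ) 2).trans
    ((MeasurableEquiv.refl ℝ).prodCongr MeasurableEquiv.finTwoArrow)
  have he : MeasurePreserving e.symm :=
    MeasurePreserving.symm e (((MeasurePreserving.id _).prod (volume_preserving_finTwoArrow ℝ)).comp
      (volume_preserving_piFinSuccAbove (fun _ : Fin 3 => ℝ) 2))
  have hes : ∀ t a b, e.symm (t, a, b) = ![a, b, t] := by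
    intro t a b
    rw [MeasurableEquiv.symm_apply_eq]
    rfl
  have hint : Integrable (fun z : ℝ × ℝ × ℝ => g ![z.2.1, z.2.2, z.1]) := by
    have := (he.integrable_comp_emb e.symm.measurableEmbedding).2 hg
    refine this.congr (Filter.Eventually.of_forall ?_)
    rintro ⟨t, a, b⟩
    simp [hes]
  have hI : ∫ x, g x = ∫ z : ℝ × ℝ × ℝ, g ![z.2.1, z.2.2, z.1] := by
    rw [← he.integral_comp e.symm.measurableEmbedding]
    congr 1
    ext ⟨t, a, b⟩
    simp [hes]
  rw [hI, Measure.volume_eq_prod]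
  rw [Measure.volume_eq_prod] at hint
  exact ⟨integral_prod _ hint, integral_prod_symm _ hint⟩

theorem isOpen_cyl (R : ℝ) : IsOpen (Cyl R) := isOpen_lt (by fun_prop) (by fun_prop)

theorem integrableOn_cyl (R : ℝ) {g : V3 → ℂ} (hc : Continuous g) (hs : AxialSupp g) :
    IntegrableOn g (Cyl R) := by
  obtain ⟨T, -, hT⟩ := hs
  have hK : IsCompact (Metric.closedBall (0 : V3) (max |R| T)) := isCompact_closedBall _ _
  refine (hc.continuousOn.integrableOn_compact hK).of_forall_sdiff_eq_zero
    (isOpen_cyl R).measurableSet ?_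
  rintro x ⟨hx, hxK⟩
  apply hT
  by_contra! h
  apply hxK
  have hx' : x 0 ^ 2 + x 1 ^ 2 < R ^ 2 := hx
  rw [mem_closedBall_zero_iff, pi_norm_le_iff_of_nonneg (le_max_of_le_left (abs_nonneg R))]
  intro i
  rw [Real.norm_eq_abs]
  fin_cases i
  · exact le_max_of_le_left (sq_le_sq.1 (show x 0 ^ 2 ≤ R ^ 2 by nlinarith [sq_nonneg (x 1)]))
  · exact le_max_of_le_left (sq_le_sq.1 (show x 1 ^ 2 ≤ R ^ 2 by nlinarith [sq_nonneg (x 0)]))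
  · exact le_max_of_le_right h.le

theorem pd_eq_zero_of_axial {g : V3 → ℂ} {T : ℝ} (h : ∀ x : V3, T ≤ |x 2| → g x = 0) (k : Fin 3)
    {x : V3} (hx : T < |x 2|) : pd k g x = 0 := by
  have : g =ᶠ[nhds x] fun _ => 0 := by
    have ho : IsOpen {y : V3 | T < |y 2|} := isOpen_lt (by fun_prop) (by fun_prop)
    filter_upwards [ho.mem_nhds hx] with y hy using h y (le_of_lt hy)
  simp [pd, this.fderiv_eq]

theorem AxialSupp.pd {g : V3 → ℂ} (hs : AxialSupp g) (k : Fin 3) : AxialSupp (pd k g) := by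
  obtain ⟨T, hT, h⟩ := hs
  exact ⟨T + 1, by linarith, fun x hx => pd_eq_zero_of_axial h k (by linarith)⟩

theorem continuous_pd {g : V3 → ℂ} (hg : ContDiff ℝ 1 g) (k : Fin 3) : Continuous (pd k g) :=
  (hg.continuous_fderiv one_ne_zero).clm_apply continuous_const

/-- Divergence theorem on the cylinder. -/
theorem integral_cyl_divergence {R : ℝ} (hR : 0 < R) {F : Fin 3 → V3 → ℂ}
    (hF : ∀ k, ContDiff ℝ 1 (F k)) (hs : ∀ k, AxialSupp (F k)) :
    ∫ x in Cyl R, ∑ k, pd k (F k) x = surfInt R (fun x => ∑ k, F k x * (nuR R x k : ℂ)) := by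
  have hm := (isOpen_cyl R).measurableSet
  have hder : ∀ k x, HasFDerivAt (F k) (fderiv ℝ (F k) x) x := fun k x =>
    ((hF k).differentiable one_ne_zero).differentiableAt.hasFDerivAt
  have hi : ∀ k, IntegrableOn (pd k (F k)) (Cyl R) := fun k =>
    integrableOn_cyl R (continuous_pd (hF k) k) ((hs k).pd k)
  have h2 : ∫ x in Cyl R, pd 2 (F 2) x = 0 := by
    rw [← integral_indicator hm, (integral_slice ((hi 2).integrable_indicator hm)).2]
    refine integral_eq_zero_of_ae (Filter.Eventually.of_forall fun p => ?_)
    by_cases hp : p.1 ^ 2 + p.2 ^ 2 < R ^ 2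
    · have hmem : ∀ t, (![p.1, p.2, t] : V3) ∈ Cyl R := fun t => by simpa [Cyl] using hp
      simp only [Set.indicator_of_mem (hmem _), Pi.zero_apply]
      have hd : ∀ t, HasDerivAt (fun t => F 2 ![p.1, p.2, t]) (pd 2 (F 2) ![p.1, p.2, t]) t := by
        intro t
        refine (hder 2 ![p.1, p.2, t]).comp_hasDerivAt t ?_
        rw [hasDerivAt_pi]
        intro i
        fin_cases i
        · simpa using hasDerivAt_const t p.1
        · simpa using hasDerivAt_const t p.2
        · simpa using hasDerivAt_id' t
      have hcs : ∀ g : V3 → ℂ, AxialSupp g →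
          HasCompactSupport (fun t => g ![p.1, p.2, t]) := by
        rintro g ⟨T, hT, h⟩
        refine HasCompactSupport.intro (isCompact_Icc (a := -T) (b := T)) fun t ht => h _ ?_
        have : ¬ |t| ≤ T := fun h' => ht (abs_le.1 h')
        simpa using (not_le.1 this).le
      have hc : Continuous fun t : ℝ => (![p.1, p.2, t] : V3) := by fun_prop
      exact integral_eq_zero_of_hasDerivAt_of_integrable hd
        (((continuous_pd (hF 2) 2).comp hc).integrable_of_hasCompactSupport (hcs _ ((hs 2).pd 2)))
        (((hF 2).continuous.comp hc).integrable_of_hasCompactSupport (hcs _ (hs 2)))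
    · have hmem : ∀ t, (![p.1, p.2, t] : V3) ∉ Cyl R := fun t => by simpa [Cyl] using hp
      simp [Set.indicator_of_notMem (hmem _)]
  have h01 : ∫ x in Cyl R, (pd 0 (F 0) x + pd 1 (F 1) x)
      = surfInt R (fun x => ∑ k, F k x * (nuR R x k : ℂ)) := by
    have hi' : IntegrableOn (fun x => pd 0 (F 0) x + pd 1 (F 1) x) (Cyl R) := (hi 0).add (hi 1)
    rw [← integral_indicator hm, (integral_slice (hi'.integrable_indicator hm)).1, surfInt]
    congr 1
    ext t
    let ι : ℝ × ℝ → V3 := fun p => ![p.1, p.2, t]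
    have hι : ContDiff ℝ 1 ι := by
      rw [contDiff_pi]
      intro i
      fin_cases i
      · exact contDiff_fst
      · exact contDiff_snd
      · exact contDiff_const
    have hιd : ∀ p u, fderiv ℝ ι p u = ![u.1, u.2, 0] := by
      intro p u
      have : HasFDerivAt ι (ContinuousLinearMap.pi
          ![ContinuousLinearMap.fst ℝ ℝ ℝ, ContinuousLinearMap.snd ℝ ℝ ℝ, 0]) p := by
        rw [hasFDerivAt_pi']
        intro i
        fin_cases i
        · exact hasFDerivAt_fst
        · exact hasFDerivAt_snd
        · exact hasFDerivAt_const _ _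
      rw [this.fderiv]
      ext i
      fin_cases i <;> simp
    have hcd : ∀ k p u, fderiv ℝ (fun p => F k (ι p)) p u
        = fderiv ℝ (F k) (ι p) ![u.1, u.2, 0] := by
      intro k p u
      have := (hder k (ι p)).comp p
        (hι.differentiable one_ne_zero).differentiableAt.hasFDerivAt
      rw [show (fun p => F k (ι p)) = F k ∘ ι from rfl, this.fderiv]
      simp [hιd]
    have key := integral_disc_divergence hR ((hF 0).comp hι) ((hF 1).comp hι)
    have e0 : (Pi.single 0 1 : V3) = ![1, 0, 0] := by ext i; fin_cases i <;> rfl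
    have e1 : (Pi.single 1 1 : V3) = ![0, 1, 0] := by ext i; fin_cases i <;> rfl
    have hmd : MeasurableSet {p : ℝ × ℝ | p.1 ^ 2 + p.2 ^ 2 < R ^ 2} :=
      (isOpen_lt (by fun_prop) (by fun_prop)).measurableSet
    rw [← integral_indicator hmd] at key
    refine Eq.trans ?_ (key.trans ?_)
    · congr 1
      ext p
      by_cases hp : p.1 ^ 2 + p.2 ^ 2 < R ^ 2
      · rw [Set.indicator_of_mem (show (![p.1, p.2, t] : V3) ∈ Cyl R by simpa [Cyl] using hp),
          Set.indicator_of_mem (show p ∈ {p : ℝ × ℝ | p.1 ^ 2 + p.2 ^ 2 < R ^ 2} from hp)]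
        simp only [pd, Function.comp_def, hcd, e0, e1]
        rfl
      · rw [Set.indicator_of_notMem (show (![p.1, p.2, t] : V3) ∉ Cyl R by simpa [Cyl] using hp),
          Set.indicator_of_notMem (show p ∉ {p : ℝ × ℝ | p.1 ^ 2 + p.2 ^ 2 < R ^ 2} from hp)]
    · congr 1
      ext θ
      simp [Fin.sum_univ_three, nuR, ι, hR.ne']
  rw [← h01]
  have := integral_add ((hi 0).add (hi 1)) (hi 2)
  simp only [Fin.sum_univ_three]
  simp only [Pi.add_apply] at this
  rw [this, h2, add_zero]

/-- A function which is `C²` up to the boundary agrees near the closure with a global `C²`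
function whose zero set is at least as large. -/
theorem UpTo.exists_extension {E : Type*} [NormedAddCommGroup E] [NormedSpace ℝ E] {S : Set V3}
    {g : V3 → E} (hg : UpTo 2 S g) :
    ∃ g' : V3 → E, ContDiff ℝ 2 g' ∧ (∀ᶠ x in nhdsSet (closure S), g' x = g x) ∧
      ∀ x, g x = 0 → g' x = 0 := by
  obtain ⟨U, hU, hSU, hgU⟩ := hg
  obtain ⟨A, hA, hSA, hAU⟩ := normal_exists_closure_subset isClosed_closure hU hSU
  obtain ⟨χ, h0, h1, -⟩ := exists_contMDiffMap_zero_one_nhds_of_isClosed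
    (n := 2) (modelWithCornersSelf ℝ V3) hA.isClosed_compl isClosed_closure
    (Set.disjoint_compl_left_iff_subset.2 hSA)
  have hχ : ContDiff ℝ 2 χ := χ.contMDiff.contDiff
  refine ⟨fun x => χ x • g x, ?_, ?_, fun x hx => by simp [hx]⟩
  · rw [contDiff_iff_contDiffAt]
    intro x
    by_cases hx : x ∈ U
    · exact hχ.contDiffAt.smul (hgU.contDiffAt (hU.mem_nhds hx))
    · have hx' : (closure A)ᶜ ∈ nhds x :=
        isClosed_closure.isOpen_compl.mem_nhds fun h => hx (hAU h)
      refine (contDiffAt_const (c := (0 : E))).congr_of_eventuallyEq ?_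
      filter_upwards [hx'] with y hy
      have : χ y = 0 := h0.self_of_nhdsSet y fun h => hy (subset_closure h)
      simp [this]
  · filter_upwards [h1] with x hx
    simp [hx]

theorem UpTo.exists_pos_extension {S : Set V3} {g : V3 → ℝ} (hg : UpTo 2 S g)
    (hpos : ∀ x ∈ closure S, 0 < g x) :
    ∃ g' : V3 → ℝ, ContDiff ℝ 2 g' ∧ (∀ x, 0 < g' x) ∧
      ∀ᶠ x in nhdsSet (closure S), g' x = g x := by
  obtain ⟨U, hU, hSU, hgU⟩ := hg
  have hU' : IsOpen (U ∩ g ⁻¹' Set.Ioi 0) := hgU.continuousOn.isOpen_inter_preimage hU isOpen_Ioi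
  have hsub : closure S ⊆ U ∩ g ⁻¹' Set.Ioi 0 := fun x hx => ⟨hSU hx, hpos x hx⟩
  have hlog : UpTo 2 S (fun x => Real.log (g x)) :=
    ⟨_, hU', hsub, (hgU.mono Set.inter_subset_left).log fun x hx => ne_of_gt hx.2⟩
  obtain ⟨l, hl, hle, -⟩ := hlog.exists_extension
  refine ⟨fun x => Real.exp (l x), hl.exp, fun x => Real.exp_pos _, ?_⟩
  filter_upwards [hle, hU'.mem_nhdsSet.2 hsub] with x hx hx'
  rw [hx, Real.exp_log hx'.2]

theorem pd_mul {g h : V3 → ℂ} (hg : Differentiable ℝ g) (hh : Differentiable ℝ h) (k : Fin 3)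
    (x : V3) : pd k (fun y => g y * h y) x = pd k g x * h x + g x * pd k h x := by
  simp only [pd]
  rw [fderiv_fun_mul (hg x) (hh x)]
  simp only [add_apply, smul_apply, smul_eq_mul]
  ring

theorem pd_add {g h : V3 → ℂ} (hg : Differentiable ℝ g) (hh : Differentiable ℝ h) (k : Fin 3)
    (x : V3) : pd k (fun y => g y + h y) x = pd k g x + pd k h x := by
  simp only [pd]
  rw [fderiv_fun_add (hg x) (hh x)]
  rfl

theorem pd_neg (g : V3 → ℂ) (k : Fin 3) (x : V3) : pd k (fun y => -g y) x = -pd k g x := by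
  simp only [pd]
  rw [fderiv_fun_neg]
  rfl

theorem pd_ofReal {g : V3 → ℝ} (hg : Differentiable ℝ g) (k : Fin 3) (x : V3) :
    pd k (fun y => (g y : ℂ)) x = (pdR k g x : ℂ) := by
  have := (Complex.ofRealCLM.hasFDerivAt (x := g x)).comp x (hg x).hasFDerivAt
  simp only [pd, pdR]
  rw [show (fun y => (g y : ℂ)) = Complex.ofRealCLM ∘ g from rfl, this.fderiv]
  simp

theorem pd_conj (g : V3 → ℂ) (k : Fin 3) (x : V3) :
    pd k (fun y => (starRingEnd ℂ) (g y)) x = (starRingEnd ℂ) (pd k g x) := by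
  simp only [pd]
  rw [show (fun y => (starRingEnd ℂ) (g y)) = Complex.conjCLE ∘ g from rfl,
    ContinuousLinearEquiv.comp_fderiv]
  simp

theorem contDiff_pd {g : V3 → ℂ} (hg : ContDiff ℝ 2 g) (k : Fin 3) : ContDiff ℝ 1 (pd k g) :=
  (hg.fderiv_right (m := 1) (by norm_num)).clm_apply contDiff_const

theorem contDiff_pdR {g : V3 → ℝ} (hg : ContDiff ℝ 2 g) (k : Fin 3) : ContDiff ℝ 1 (pdR k g) :=
  (hg.fderiv_right (m := 1) (by norm_num)).clm_apply contDiff_const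

theorem pd_comm {g : V3 → ℂ} (hg : ContDiff ℝ 2 g) (j k : Fin 3) (x : V3) :
    pd j (pd k g) x = pd k (pd j g) x := by
  have hsymm : IsSymmSndFDerivAt ℝ g x := hg.contDiffAt.isSymmSndFDerivAt (by simp)
  have hd : DifferentiableAt ℝ (fderiv ℝ g) x :=
    ((hg.fderiv_right (m := 1) (by norm_num)).differentiable one_ne_zero).differentiableAt
  have h : ∀ a b : Fin 3, pd a (pd b g) x
      = fderiv ℝ (fderiv ℝ g) x (Pi.single a 1) (Pi.single b 1) := by
    intro a b
    unfold pd
    rw [fderiv_clm_apply hd (differentiableAt_const _)]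
    simp
  rw [h, h]
  exact hsymm _ _

theorem pd_sum {g : Fin 3 → V3 → ℂ} (hg : ∀ i, Differentiable ℝ (g i)) (k : Fin 3) (x : V3) :
    pd k (fun y => ∑ i, g i y) x = ∑ i, pd k (g i) x := by
  simp only [Fin.sum_univ_three]
  rw [pd_add ((hg 0).fun_add (hg 1)) (hg 2), pd_add (hg 0) (hg 1)]

/-- If the field with horizontal components `a`, `b` has vanishing normal component on the boundary
of the cylinder, then its tangential derivative in the normal direction is given by the curvature
of the boundary. -/
theorem normal_tangential_derivative {R : ℝ} (hR : 0 < R) {a b : V3 → ℂ} (ha : ContDiff ℝ 1 a)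
    (hb : ContDiff ℝ 1 b) (h : ∀ x ∈ bCyl R, (x 0 : ℂ) * a x + (x 1 : ℂ) * b x = 0) (θ t : ℝ)
    {w : C3} (hw : (Real.cos θ : ℂ) * w 0 + (Real.sin θ : ℂ) * w 1 = 0) :
    (R : ℂ) * ∑ j, w j * ((Real.cos θ : ℂ) * pd j a ![R * Real.cos θ, R * Real.sin θ, t]
        + (Real.sin θ : ℂ) * pd j b ![R * Real.cos θ, R * Real.sin θ, t])
      = -(w 0 * a ![R * Real.cos θ, R * Real.sin θ, t]
        + w 1 * b ![R * Real.cos θ, R * Real.sin θ, t]) := by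
  have hRC : (R : ℂ) ≠ 0 := by exact_mod_cast hR.ne'
  have hsc : ((Real.sin θ : ℝ) : ℂ) ^ 2 + ((Real.cos θ : ℝ) : ℂ) ^ 2 = 1 := by
    exact_mod_cast Real.sin_sq_add_cos_sq θ
  set c : ℝ → ℝ → V3 := fun θ t => ![R * Real.cos θ, R * Real.sin θ, t] with hc
  have hbc : ∀ θ t : ℝ, (Real.cos θ : ℂ) * a (c θ t) + (Real.sin θ : ℂ) * b (c θ t) = 0 := by
    intro θ t
    have h1 := h (c θ t) (by
      show (R * Real.cos θ) ^ 2 + (R * Real.sin θ) ^ 2 = R ^ 2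
      linear_combination R ^ 2 * Real.sin_sq_add_cos_sq θ)
    simp only [hc, Matrix.cons_val_zero, Matrix.cons_val_one, Complex.ofReal_mul] at h1
    refine (mul_eq_zero.1 (?_ : (R : ℂ) * _ = 0)).resolve_left hRC
    linear_combination h1
  have hθ : ∀ g : V3 → ℂ, ContDiff ℝ 1 g → HasDerivAt (fun s => g (c s t))
      (((-(R * Real.sin θ) : ℝ) : ℂ) * pd 0 g (c θ t) + ((R * Real.cos θ : ℝ) : ℂ) * pd 1 g (c θ t))
      θ := by
    intro g hg
    have hcd : HasDerivAt (fun s => c s t) ((-(R * Real.sin θ)) • (Pi.single 0 1 : V3)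
        + (R * Real.cos θ) • (Pi.single 1 1 : V3)) θ := by
      rw [hasDerivAt_pi]
      intro i
      fin_cases i
      · simpa [hc] using (Real.hasDerivAt_cos θ).const_mul R
      · simpa [hc] using (Real.hasDerivAt_sin θ).const_mul R
      · simpa [hc] using hasDerivAt_const θ t
    have := ((hg.differentiable one_ne_zero).differentiableAt.hasFDerivAt
      (x := c θ t)).comp_hasDerivAt θ hcd
    simp only [map_add, map_smul, Complex.real_smul] at this
    exact this
  have ht : ∀ g : V3 → ℂ, ContDiff ℝ 1 g →
      HasDerivAt (fun s => g (c θ s)) (pd 2 g (c θ t)) t := by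
    intro g hg
    have hcd : HasDerivAt (fun s => c θ s) (Pi.single 2 1 : V3) t := by
      rw [hasDerivAt_pi]
      intro i
      fin_cases i
      · simpa [hc] using hasDerivAt_const t (R * Real.cos θ)
      · simpa [hc] using hasDerivAt_const t (R * Real.sin θ)
      · simpa [hc] using hasDerivAt_id' t
    exact ((hg.differentiable one_ne_zero).differentiableAt.hasFDerivAt
      (x := c θ t)).comp_hasDerivAt t hcd
  have E1 := ((Real.hasDerivAt_cos θ).ofReal_comp.mul (hθ a ha)).add
    ((Real.hasDerivAt_sin θ).ofReal_comp.mul (hθ b hb))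
  have E1' := E1.unique ((hasDerivAt_const θ (0 : ℂ)).congr_of_eventuallyEq
    (Filter.Eventually.of_forall fun s => hbc s t))
  have E2 := ((ht a ha).const_mul (Real.cos θ : ℂ)).add ((ht b hb).const_mul (Real.sin θ : ℂ))
  have E2' := E2.unique ((hasDerivAt_const t (0 : ℂ)).congr_of_eventuallyEq
    (Filter.Eventually.of_forall fun s => hbc θ s))
  have hw0 : w 0 = -(Real.sin θ : ℂ) * ((Real.cos θ : ℂ) * w 1 - (Real.sin θ : ℂ) * w 0) := by
    linear_combination -w 0 * hsc + (Real.cos θ : ℂ) * hw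
  have hw1 : w 1 = (Real.cos θ : ℂ) * ((Real.cos θ : ℂ) * w 1 - (Real.sin θ : ℂ) * w 0) := by
    linear_combination -w 1 * hsc + (Real.sin θ : ℂ) * hw
  set α := (Real.cos θ : ℂ) * w 1 - (Real.sin θ : ℂ) * w 0
  rw [Fin.sum_univ_three, hw0, hw1]
  change _ = -(_ * a (c θ t) + _ * b (c θ t))
  push_cast at E1' E2' ⊢
  linear_combination α * E1' + (R : ℂ) * w 2 * E2'

theorem surfInt_congr {R : ℝ} {F G : V3 → ℂ}
    (h : ∀ θ t : ℝ,
      F ![R * Real.cos θ, R * Real.sin θ, t] = G ![R * Real.cos θ, R * Real.sin θ, t]) :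
    surfInt R F = surfInt R G := by
  simp only [surfInt, h]

theorem setIntegral_eq_of_add_eq {S : Set V3} (hS : MeasurableSet S) {a b c d g : V3 → ℂ}
    (h : ∀ x ∈ S, a x + b x = c x + d x + g x) (ha : IntegrableOn a S) (hb : IntegrableOn b S)
    (hc : IntegrableOn c S) (hd : IntegrableOn d S) (hg : IntegrableOn g S) :
    ∫ x in S, a x = (∫ x in S, c x) - (∫ x in S, b x) + (∫ x in S, d x) + ∫ x in S, g x := by
  have h1 := setIntegral_congr_fun (μ := volume) hS h
  rw [integral_add ha hb, integral_add (show Integrable (fun x => c x + d x) _ from hc.add hd) hg,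
    integral_add hc hd] at h1
  linear_combination h1

/-- The identity for globally defined coefficients and fields. -/
theorem integral_curl_curl_of_contDiff (R : ℝ) (hR : 0 < R) (ε μ : V3 → ℝ) (v f : V3 → C3)
    (hε : ContDiff ℝ 2 ε) (hμ : ContDiff ℝ 2 μ) (hεpos : ∀ x, 0 < ε x) (hμpos : ∀ x, 0 < μ x)
    (hv : ContDiff ℝ 2 v) (hf : ContDiff ℝ 2 f) (hvs : AxialSupp v)
    (hdiv : ∀ x ∈ Cyl R, vdiv (fun y => (μ y : ℂ) • v y) x = 0)
    (hvbc : ∀ x ∈ bCyl R, ncomp R x (v x) = 0)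
    (hfbc : ∀ x ∈ bCyl R, ncomp R x (f x) = 0) :
    ∫ x in Cyl R, (((ε x)⁻¹ : ℝ) : ℂ) * hinner (vcurl v x) (vcurl f x)
      = (∫ x in Cyl R, ∑ j, hinner (pdV j (fun y => (Real.sqrt (μ y) : ℂ) • v y) x)
            (pdV j (fun y => (((ε y)⁻¹ * (Real.sqrt (μ y))⁻¹ : ℝ) : ℂ) • f y) x))
        - (∫ x in Cyl R, hinner (vcurl v x)
            ((μ x : ℂ) • cross (gradC (fun y => (ε y * μ y)⁻¹) x) (f x)))
        + (∫ x in Cyl R, (((ε x)⁻¹ : ℝ) : ℂ)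
            * hinner (fun j => ∑ k, (Wm μ x j k : ℂ) * v x k) (f x))
        + surfInt R (fun x => hinner
            (fun j => (((ε x)⁻¹ * R⁻¹ * (if j = 2 then 0 else 1)
                - (2 * ε x * μ x)⁻¹ * dnu R μ x : ℝ) : ℂ) * v x j)
            (f x)) := by
  set s : V3 → ℝ := fun x => √(μ x) with hs_def
  have hspos : ∀ x, 0 < s x := fun x => Real.sqrt_pos.2 (hμpos x)
  have hs : ContDiff ℝ 2 s := hμ.sqrt fun x => (hμpos x).ne'
  have hμs : ∀ x, μ x = s x * s x := fun x => (Real.mul_self_sqrt (hμpos x).le).symm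
  set S : V3 → ℂ := fun x => (s x : ℂ) with hS_def
  set e : V3 → ℂ := fun x => (ε x : ℂ) with he_def
  have hofReal : ∀ {g : V3 → ℝ}, ContDiff ℝ 2 g → ContDiff ℝ 2 (fun x => (g x : ℂ)) :=
    fun hg => Complex.ofRealCLM.contDiff.comp hg
  have hS : ContDiff ℝ 2 S := hofReal hs
  have he : ContDiff ℝ 2 e := hofReal hε
  have hS0 : ∀ x, S x ≠ 0 := fun x => by simpa [hS_def] using (hspos x).ne'
  have he0 : ∀ x, e x ≠ 0 := fun x => by simpa [he_def] using (hεpos x).ne'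
  -- the rescaled conjugate of `f`
  set V : Fin 3 → V3 → ℂ := fun k x => v x k with hV_def
  set q : V3 → ℂ := fun x => e x * (S x * S x) with hq_def
  set p : V3 → ℝ := fun x => (ε x * μ x)⁻¹ with hp_def
  have hp : ContDiff ℝ 2 p := (hε.mul hμ).inv fun x => (mul_pos (hεpos x) (hμpos x)).ne'
  set P : V3 → ℂ := fun x => (p x : ℂ) with hP_def
  have hP : ContDiff ℝ 2 P := hofReal hp
  have hq : ContDiff ℝ 2 q := he.mul (hS.mul hS)
  have hqP : ∀ x, q x * P x = 1 := by
    intro x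
    have h1 := hS0 x
    have h2 := he0 x
    simp only [hS_def, he_def, ne_eq] at h1 h2
    simp only [hq_def, hP_def, hp_def, hS_def, he_def, hμs]
    push_cast
    field_simp
  have hf' : ∀ k, ContDiff ℝ 2 (fun x => f x k) := fun k => contDiff_pi.1 hf k
  have hV : ∀ k, ContDiff ℝ 2 (V k) := fun k => contDiff_pi.1 hv k
  have hcf : ∀ k, ContDiff ℝ 2 (fun x => (starRingEnd ℂ) (f x k)) := fun k =>
    Complex.conjCLE.contDiff.comp (hf' k)
  set W : Fin 3 → V3 → ℂ := fun k x => P x * (starRingEnd ℂ) (f x k) with hW_def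
  have hW : ∀ k, ContDiff ℝ 2 (W k) := fun k => hP.mul (hcf k)
  have hfW : ∀ k x, (starRingEnd ℂ) (f x k) = q x * W k x := by
    intro k x
    rw [hW_def]
    linear_combination -(starRingEnd ℂ) (f x k) * hqP x
  have dS := hS.differentiable two_ne_zero
  have dq := hq.differentiable two_ne_zero
  have dP := hP.differentiable two_ne_zero
  have dV := fun k => (hV k).differentiable two_ne_zero
  have dW := fun k => (hW k).differentiable two_ne_zero
  have dpS := fun k => (contDiff_pd hS k).differentiable one_ne_zero
  have dpV := fun j k => (contDiff_pd (hV k) j).differentiable one_ne_zero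
  have cS := hS.continuous
  have cV := fun k => (hV k).continuous
  have cW := fun k => (hW k).continuous
  have cpS := fun k => continuous_pd (hS.of_le one_le_two) k
  have cppS := fun j k => continuous_pd (contDiff_pd hS k) j
  have cpV := fun j k => continuous_pd ((hV k).of_le one_le_two) j
  have cpW := fun j k => continuous_pd ((hW k).of_le one_le_two) j
  -- derivatives of the coefficients
  have hpdμ : ∀ k x, (pdR k μ x : ℂ) = 2 * (S x * pd k S x) := by
    intro k x
    rw [← pd_ofReal (hμ.differentiable two_ne_zero)]
    have : (fun y => (μ y : ℂ)) = fun y => S y * S y := by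
      ext y; simp [hS_def, hμs]
    rw [this, pd_mul dS dS]
    ring
  have hppμ : ∀ j k x, (pdR j (fun y => pdR k μ y) x : ℂ)
      = 2 * (pd j S x * pd k S x + S x * pd j (pd k S) x) := by
    intro j k x
    have h1 : Differentiable ℝ (pdR k μ) := (contDiff_pdR hμ k).differentiable one_ne_zero
    change ((pdR j (pdR k μ) x : ℝ) : ℂ) = _
    rw [← pd_ofReal h1]
    have : (fun y => (pdR k μ y : ℂ)) = fun y => S y * pd k S y + S y * pd k S y := by
      ext y; rw [hpdμ]; ring
    rw [this, pd_add (dS.fun_mul (dpS k)) (dS.fun_mul (dpS k)), pd_mul dS (dpS k)]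
    ring
  have hpdf : ∀ j k x, (starRingEnd ℂ) (pd j (fun y => f y k) x)
      = pd j q x * W k x + q x * pd j (W k) x := by
    intro j k x
    rw [← pd_conj]
    simp only [hfW]
    exact pd_mul dq (dW k) j x
  have hpdP : ∀ k x, pd k q x * P x + q x * pd k P x = 0 := by
    intro k x
    rw [← pd_mul dq dP]
    simp only [hqP]
    simp [pd]
  have hpp : ∀ k x, (pdR k p x : ℂ) = pd k P x := fun k x =>
    (pd_ofReal (hp.differentiable two_ne_zero) k x).symm
  -- the divergence condition and its derivative
  have hD : ∀ x ∈ Cyl R, ∑ k, (2 * pd k S x * V k x + S x * pd k (V k) x) = 0 := by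
    intro x hx
    have h1 := hdiv x hx
    have h2 : ∀ k, pd k (fun y => ((μ y : ℂ) • v y) k) x
        = S x * (2 * pd k S x * V k x + S x * pd k (V k) x) := by
      intro k
      have : (fun y => ((μ y : ℂ) • v y) k) = fun y => (S y * S y) * V k y := by
        ext y; simp [hS_def, hV_def, hμs]
      rw [this, pd_mul (dS.fun_mul dS) (dV k), pd_mul dS dS]
      ring
    simp only [vdiv, h2] at h1
    rw [← Finset.mul_sum] at h1
    exact (mul_eq_zero.1 h1).resolve_left (hS0 x)
  have hDj : ∀ x ∈ Cyl R, ∀ j, ∑ k, (2 * pd j (pd k S) x * V k x + 2 * pd k S x * pd j (V k) x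
      + pd j S x * pd k (V k) x + S x * pd j (pd k (V k)) x) = 0 := by
    intro x hx j
    have h0 : pd j (fun y => ∑ k, ((pd k S y * V k y + pd k S y * V k y)
        + S y * pd k (V k) y)) x = 0 := by
      have : (fun y => ∑ k, ((pd k S y * V k y + pd k S y * V k y) + S y * pd k (V k) y))
          =ᶠ[nhds x] fun _ => 0 := by
        filter_upwards [(isOpen_cyl R).mem_nhds hx] with y hy
        rw [← hD y hy]
        exact Finset.sum_congr rfl fun k _ => by ring
      rw [pd, this.fderiv_eq]
      simp
    have d1 := fun k => (dpS k).fun_mul (dV k)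
    have d2 := fun k => dS.fun_mul (dpV k k)
    rw [pd_sum fun k => ((d1 k).fun_add (d1 k)).fun_add (d2 k)] at h0
    rw [← h0]
    refine Finset.sum_congr rfl fun k _ => ?_
    rw [pd_add ((d1 k).fun_add (d1 k)) (d2 k), pd_add (d1 k) (d1 k), pd_mul (dpS k) (dV k),
      pd_mul dS (dpV k k)]
    ring
  -- the four volume integrands
  have hμC : ∀ x, (μ x : ℂ) = S x * S x := fun x => by simp [hS_def, hμs]
  have hεC : ∀ x, (((ε x)⁻¹ : ℝ) : ℂ) = (e x)⁻¹ := fun x => by simp [he_def]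
  have hI0 : ∀ x, (((ε x)⁻¹ : ℝ) : ℂ) * hinner (vcurl v x) (vcurl f x) = (e x)⁻¹ *
      ((pd 1 (V 2) x - pd 2 (V 1) x) * ((pd 1 q x * W 2 x + q x * pd 1 (W 2) x)
          - (pd 2 q x * W 1 x + q x * pd 2 (W 1) x))
        + (pd 2 (V 0) x - pd 0 (V 2) x) * ((pd 2 q x * W 0 x + q x * pd 2 (W 0) x)
          - (pd 0 q x * W 2 x + q x * pd 0 (W 2) x))
        + (pd 0 (V 1) x - pd 1 (V 0) x) * ((pd 0 q x * W 1 x + q x * pd 0 (W 1) x)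
          - (pd 1 q x * W 0 x + q x * pd 1 (W 0) x))) := by
    intro x
    simp [hinner, vcurl, Fin.sum_univ_three, hpdf, hεC, hV_def]
  have hI2 : ∀ x, hinner (vcurl v x) ((μ x : ℂ) • cross (gradC p x) (f x))
      = S x * S x *
      ((pd 1 (V 2) x - pd 2 (V 1) x) * (pd 1 P x * (q x * W 2 x) - pd 2 P x * (q x * W 1 x))
        + (pd 2 (V 0) x - pd 0 (V 2) x) * (pd 2 P x * (q x * W 0 x) - pd 0 P x * (q x * W 2 x))
        + (pd 0 (V 1) x - pd 1 (V 0) x) * (pd 0 P x * (q x * W 1 x) - pd 1 P x * (q x * W 0 x)))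
      := by
    intro x
    have h1 : ∀ k, gradC p x k = (pdR k p x : ℂ) := fun k => rfl
    simp only [hinner, vcurl, cross, h1, Fin.sum_univ_three, Pi.smul_apply, smul_eq_mul,
      Matrix.cons_val_zero, Matrix.cons_val_one, Matrix.cons_val, map_mul, map_sub,
      hfW, hpp, hμC, hV_def]
    rw [show (starRingEnd ℂ) (S x) = S x from Complex.conj_ofReal _]
    simp only [← hpp, Complex.conj_ofReal]
    ring
  have hI1 : ∀ x, ∑ j, hinner (pdV j (fun y => (Real.sqrt (μ y) : ℂ) • v y) x)
      (pdV j (fun y => (((ε y)⁻¹ * (Real.sqrt (μ y))⁻¹ : ℝ) : ℂ) • f y) x)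
      = ∑ j, ∑ k, (pd j S x * V k x + S x * pd j (V k) x)
          * (pd j S x * W k x + S x * pd j (W k) x) := by
    intro x
    refine Finset.sum_congr rfl fun j _ => Finset.sum_congr rfl fun k _ => ?_
    rw [← pd_mul dS (dV k), ← pd_mul dS (dW k)]
    congr 1
    simp only [pdV]
    rw [← pd_conj]
    congr 1
    ext y
    simp only [Pi.smul_apply, smul_eq_mul, map_mul, Complex.conj_ofReal, hfW]
    have h1 := hS0 y
    have h2 := he0 y
    have h3 : (((ε y)⁻¹ * (√(μ y))⁻¹ : ℝ) : ℂ) = (e y)⁻¹ * (S y)⁻¹ := by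
      simp [he_def, hS_def, hs_def]
    rw [h3, hq_def]
    field_simp
  have hWm : ∀ x j k, S x * S x * (Wm μ x j k : ℂ)
      = (S x * ∑ i, pd i (pd i S) x) * (if j = k then 1 else 0)
        + 2 * (pd j S x * pd k S x) - 2 * (S x * pd j (pd k S) x) := by
    intro x j k
    have h1 := hS0 x
    simp only [Wm, lapR]
    push_cast
    simp only [hpdμ, hppμ, hμC, Fin.sum_univ_three]
    split_ifs <;> (field_simp; push_cast; ring)
  have hI3 : ∀ x, (((ε x)⁻¹ : ℝ) : ℂ) * hinner (fun j => ∑ k, (Wm μ x j k : ℂ) * v x k) (f x)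
      = ∑ j, ∑ k, ((S x * ∑ i, pd i (pd i S) x) * (if j = k then 1 else 0)
        + 2 * (pd j S x * pd k S x) - 2 * (S x * pd j (pd k S) x)) * V k x * W j x := by
    intro x
    have h2 := he0 x
    simp only [← hWm]
    simp only [hinner, hfW, hεC, Finset.mul_sum, Finset.sum_mul]
    refine Finset.sum_congr rfl fun j _ => Finset.sum_congr rfl fun k _ => ?_
    rw [hq_def, hV_def]
    field_simp
  -- the flux field
  set F : Fin 3 → V3 → ℂ := fun k x => ∑ j, -(S x * pd k S x * (V j x * W j x)
    + S x * S x * (pd j (V k) x * W j x)) with hF_def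
  have hdivF : ∀ x k, pd k (F k) x = ∑ j, -((pd k S x * pd k S x + S x * pd k (pd k S) x)
        * (V j x * W j x) + S x * pd k S x * (pd k (V j) x * W j x + V j x * pd k (W j) x)
      + (2 * S x * pd k S x * (pd j (V k) x * W j x)
        + S x * S x * (pd j (pd k (V k)) x * W j x + pd j (V k) x * pd k (W j) x))) := by
    intro x k
    have d1 := fun j => (dS.fun_mul (dpS k)).fun_mul ((dV j).fun_mul (dW j))
    have d2 := fun j => (dS.fun_mul dS).fun_mul ((dpV j k).fun_mul (dW j))
    rw [hF_def, pd_sum fun j => ((d1 j).fun_add (d2 j)).fun_neg]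
    refine Finset.sum_congr rfl fun j _ => ?_
    rw [pd_neg, pd_add (d1 j) (d2 j), pd_mul (dS.fun_mul (dpS k)) ((dV j).fun_mul (dW j)),
      pd_mul dS (dpS k), pd_mul (dV j) (dW j), pd_mul (dS.fun_mul dS) ((dpV j k).fun_mul (dW j)),
      pd_mul dS dS, pd_mul (dpV j k) (dW j), pd_comm (hV k) k j]
    ring
  have hpoint : ∀ x ∈ Cyl R, ((e x)⁻¹ *
      ((pd 1 (V 2) x - pd 2 (V 1) x) * ((pd 1 q x * W 2 x + q x * pd 1 (W 2) x)
          - (pd 2 q x * W 1 x + q x * pd 2 (W 1) x))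
        + (pd 2 (V 0) x - pd 0 (V 2) x) * ((pd 2 q x * W 0 x + q x * pd 2 (W 0) x)
          - (pd 0 q x * W 2 x + q x * pd 0 (W 2) x))
        + (pd 0 (V 1) x - pd 1 (V 0) x) * ((pd 0 q x * W 1 x + q x * pd 0 (W 1) x)
          - (pd 1 q x * W 0 x + q x * pd 1 (W 0) x))))
      + S x * S x *
      ((pd 1 (V 2) x - pd 2 (V 1) x) * (pd 1 P x * (q x * W 2 x) - pd 2 P x * (q x * W 1 x))
        + (pd 2 (V 0) x - pd 0 (V 2) x) * (pd 2 P x * (q x * W 0 x) - pd 0 P x * (q x * W 2 x))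
        + (pd 0 (V 1) x - pd 1 (V 0) x) * (pd 0 P x * (q x * W 1 x) - pd 1 P x * (q x * W 0 x)))
      = (∑ j, ∑ k, (pd j S x * V k x + S x * pd j (V k) x)
          * (pd j S x * W k x + S x * pd j (W k) x))
        + (∑ j, ∑ k, ((S x * ∑ i, pd i (pd i S) x) * (if j = k then 1 else 0)
        + 2 * (pd j S x * pd k S x) - 2 * (S x * pd j (pd k S) x)) * V k x * W j x)
        + ∑ k, pd k (F k) x := by
    intro x hx
    have h1 := hS0 x
    have h2 := he0 x
    have hP' : P x = (e x)⁻¹ * (S x * S x)⁻¹ := by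
      have h3 := hqP x
      rw [hq_def] at h3
      field_simp
      linear_combination h3
    have hq' : q x = e x * (S x * S x) := rfl
    have hPk : ∀ k, pd k P x = -(pd k q x * P x * P x) := by
      intro k
      linear_combination P x * hpdP k x - pd k P x * hqP x
    have hcurl : ∀ a b c : ℂ, ∀ i j k l : Fin 3, (e x)⁻¹ * (a * ((pd i q x * W j x + q x * b)
          - (pd k q x * W l x + q x * c)))
        + S x * S x * (a * (pd i P x * (q x * W j x) - pd k P x * (q x * W l x)))
        = S x * S x * (a * (b - c)) := by
      intro a b c i j k l
      rw [hPk, hPk, hP', hq']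
      field_simp
      ring
    have hD' := hD x hx
    have hDj' := hDj x hx
    have t0 := hcurl (pd 1 (V 2) x - pd 2 (V 1) x) (pd 1 (W 2) x) (pd 2 (W 1) x) 1 2 2 1
    have t1 := hcurl (pd 2 (V 0) x - pd 0 (V 2) x) (pd 2 (W 0) x) (pd 0 (W 2) x) 2 0 0 2
    have t2 := hcurl (pd 0 (V 1) x - pd 1 (V 0) x) (pd 0 (W 1) x) (pd 1 (W 0) x) 0 1 1 0
    have hE : ∑ j, W j x * S x * ∑ k, (2 * pd j (pd k S) x * V k x
        + 2 * pd k S x * pd j (V k) x + pd j S x * pd k (V k) x + S x * pd j (pd k (V k)) x) = 0 :=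
      Finset.sum_eq_zero fun j _ => by rw [hDj' j, mul_zero]
    have hE' : (∑ j, W j x * pd j S x)
        * ∑ k, (2 * pd k S x * V k x + S x * pd k (V k) x) = 0 := by rw [hD', mul_zero]
    simp only [hdivF]
    clear hDj' hD' hcurl
    simp only [Fin.sum_univ_three] at hE hE' ⊢
    simp only [Fin.isValue, reduceIte, Fin.reduceEq, zero_ne_one, one_ne_zero]
    linear_combination t0 + t1 + t2 + hE - hE'
  obtain ⟨T, hT0, hvT⟩ := hvs
  have hT : ∀ x : V3, T + 1 ≤ |x 2| → (∀ k, V k x = 0) ∧ ∀ j k, pd j (V k) x = 0 := by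
    have hVT : ∀ k (x : V3), T ≤ |x 2| → V k x = 0 := fun k x hx => by simp [hV_def, hvT x hx]
    exact fun x hx => ⟨fun k => hVT k x (by linarith),
      fun j k => pd_eq_zero_of_axial (hVT k) j (by linarith)⟩
  replace hT0 : 0 < T + 1 := by linarith
  have hFT : ∀ k (x : V3), T + 1 ≤ |x 2| → F k x = 0 := fun k x hx => by
    simp [hF_def, (hT x hx).1, (hT x hx).2]
  have cq := hq.continuous
  have cpq := fun k => continuous_pd (hq.of_le one_le_two) k
  have cpP := fun k => continuous_pd (hP.of_le one_le_two) k
  have cei : Continuous fun x => (e x)⁻¹ := he.continuous.inv₀ he0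
  have hF : ∀ k, ContDiff ℝ 1 (F k) := fun k => by
    have g1 := contDiff_pd hS
    have g2 := fun j k => contDiff_pd (hV k) j
    have g3 := hS.of_le one_le_two
    have g4 := fun k => (hV k).of_le one_le_two
    have g5 := fun k => (hW k).of_le one_le_two
    exact ContDiff.sum fun j _ => ((g3.mul (g1 k)).mul ((g4 j).mul (g5 j))
      |>.add ((g3.mul g3).mul ((g2 j k).mul (g5 j)))).neg
  simp only [hI0, hI1, hI2, hI3]
  rw [setIntegral_eq_of_add_eq (isOpen_cyl R).measurableSet hpoint,
    integral_cyl_divergence hR hF fun k => ⟨T + 1, hT0, hFT k⟩]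
  · refine congrArg _ (surfInt_congr fun θ t => ?_)
    set x : V3 := ![R * Real.cos θ, R * Real.sin θ, t] with hx_def
    have hx0 : x 0 = R * Real.cos θ := rfl
    have hx1 : x 1 = R * Real.sin θ := rfl
    have hRC : (R : ℂ) ≠ 0 := by exact_mod_cast hR.ne'
    have hRR : ∀ a : ℝ, R * a / R = a := fun a => by field_simp
    have hxb : x ∈ bCyl R := by
      simp only [bCyl, Set.mem_ofPred_eq, hx0, hx1]
      linear_combination R ^ 2 * Real.cos_sq_add_sin_sq θ
    have hn := normal_tangential_derivative hR ((hV 0).of_le one_le_two)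
      ((hV 1).of_le one_le_two) (fun y hy => by
        have := hvbc y hy
        simp only [ncomp, nuR, Fin.sum_univ_three, Matrix.cons_val_zero, Matrix.cons_val_one,
          Matrix.cons_val] at this
        push_cast at this
        field_simp at this
        simpa [hV_def, mul_comm] using this) θ t (w := fun j => W j x) (by
        have := congrArg (starRingEnd ℂ) (hfbc x hxb)
        simp only [ncomp, nuR, Fin.sum_univ_three, Matrix.cons_val_zero, Matrix.cons_val_one,
          Matrix.cons_val, hx0, hx1, hRR, map_add, map_mul, map_zero, Complex.conj_ofReal,
          Complex.ofReal_zero, mul_zero, add_zero] at this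
        simp only [hW_def]
        linear_combination P x * this)
    rw [← hx_def] at hn
    have h1 := hS0 x
    have h2 := he0 x
    simp only [hinner, hF_def, dnu, nuR, Fin.sum_univ_three, Matrix.cons_val_zero,
      Matrix.cons_val_one, Matrix.cons_val, hx0, hx1, hRR, hfW] at hn ⊢
    push_cast at hn ⊢
    simp only [hpdμ, hμC, show (ε x : ℂ) = e x from rfl, show q x = e x * (S x * S x) from rfl,
      show ∀ j, v x j = V j x from fun _ => rfl]
    field_simp
    linear_combination -S x * hn
  · exact integrableOn_cyl R (by fun_prop) ⟨T + 1, hT0, fun x hx => by simp [(hT x hx).2]⟩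
  · exact integrableOn_cyl R (by fun_prop) ⟨T + 1, hT0, fun x hx => by simp [(hT x hx).2]⟩
  · exact integrableOn_cyl R (by fun_prop) ⟨T + 1, hT0, fun x hx => by simp [hT x hx]⟩
  · exact integrableOn_cyl R (by fun_prop) ⟨T + 1, hT0, fun x hx => by simp [(hT x hx).1]⟩
  · exact integrableOn_cyl R (continuous_finsetSum _ fun k _ => continuous_pd (hF k) k)
      ⟨T + 2, by linarith, fun x hx => Finset.sum_eq_zero fun k _ =>
        pd_eq_zero_of_axial (hFT k) k (by linarith)⟩

section congruence

variable {x : V3}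

theorem pd_congr {g h : V3 → ℂ} (e : g =ᶠ[nhds x] h) (j : Fin 3) : pd j g x = pd j h x := by
  rw [pd, pd, e.fderiv_eq]

theorem pdR_congr {g h : V3 → ℝ} (e : g =ᶠ[nhds x] h) (j : Fin 3) : pdR j g x = pdR j h x := by
  rw [pdR, pdR, e.fderiv_eq]

theorem eventuallyEq_pdR {g h : V3 → ℝ} (e : g =ᶠ[nhds x] h) (j : Fin 3) :
    pdR j g =ᶠ[nhds x] pdR j h :=
  e.eventuallyEq_nhds.mono fun _ hy => pdR_congr hy j

theorem pdV_congr {a b : V3 → C3} (e : a =ᶠ[nhds x] b) (j : Fin 3) : pdV j a x = pdV j b x :=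
  funext fun i => pd_congr (e.fun_comp fun z => z i) j

theorem vdiv_congr {a b : V3 → C3} (e : a =ᶠ[nhds x] b) : vdiv a x = vdiv b x :=
  Finset.sum_congr rfl fun j _ => pd_congr (e.fun_comp fun z => z j) j

theorem vcurl_congr {a b : V3 → C3} (e : a =ᶠ[nhds x] b) : vcurl a x = vcurl b x := by
  have h := fun i j => pd_congr (e.fun_comp fun z => z i) j
  simp only [Function.comp_def] at h
  simp only [vcurl, h]

theorem gradC_congr {g h : V3 → ℝ} (e : g =ᶠ[nhds x] h) : gradC g x = gradC h x :=
  funext fun j => by rw [gradC, gradC, pdR_congr e j]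

theorem dnu_congr {g h : V3 → ℝ} (e : g =ᶠ[nhds x] h) (R : ℝ) : dnu R g x = dnu R h x := by
  simp only [dnu, pdR_congr e]

theorem Wm_congr {g h : V3 → ℝ} (e : g =ᶠ[nhds x] h) (j k : Fin 3) : Wm g x j k = Wm h x j k := by
  have h1 := pdR_congr e
  have h2 := fun i j => pdR_congr (eventuallyEq_pdR e i) j
  simp only [Wm, lapR, h1, h2, e.eq_of_nhds]

end congruence

theorem bCyl_subset_closure {R : ℝ} (hR : 0 < R) : bCyl R ⊆ closure (Cyl R) := by
  intro x hx
  have h1 : (1 : ℝ) ∈ closure (Set.Ico (0 : ℝ) 1) := by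
    rw [closure_Ico zero_ne_one]
    exact Set.right_mem_Icc.2 zero_le_one
  have h2 : Set.MapsTo (fun r : ℝ => r • x) (Set.Ico 0 1) (Cyl R) := by
    rintro r ⟨h0, hr⟩
    simp only [bCyl, Set.mem_ofPred_eq] at hx
    simp only [Cyl, Set.mem_ofPred_eq, Pi.smul_apply, smul_eq_mul, mul_pow, ← mul_add, hx]
    have : r ^ 2 < 1 := by nlinarith
    nlinarith [pow_pos hR 2]
  simpa using map_mem_closure (f := fun r : ℝ => r • x) (by fun_prop) h1 h2

/-- the identity of Lemma 3.2 (v and f with vanishing normal components). -/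
theorem statement11 (R : ℝ) (hR : 0 < R) (ε μ : V3 → ℝ) (v f : V3 → C3)
    (hε : UpTo 2 (Cyl R) ε) (hμ : UpTo 2 (Cyl R) μ)
    (hεpos : ∀ x ∈ closure (Cyl R), 0 < ε x) (hμpos : ∀ x ∈ closure (Cyl R), 0 < μ x)
    (hv : UpTo 2 (Cyl R) v) (hf : UpTo 2 (Cyl R) f) (hvs : AxialSupp v)
    (hdiv : ∀ x ∈ Cyl R, vdiv (fun y => (μ y : ℂ) • v y) x = 0)
    (hvbc : ∀ x ∈ bCyl R, ncomp R x (v x) = 0)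
    (hfbc : ∀ x ∈ bCyl R, ncomp R x (f x) = 0) :
    ∫ x in Cyl R, (((ε x)⁻¹ : ℝ) : ℂ) * hinner (vcurl v x) (vcurl f x)
      = (∫ x in Cyl R, ∑ j, hinner (pdV j (fun y => (Real.sqrt (μ y) : ℂ) • v y) x)
            (pdV j (fun y => (((ε y)⁻¹ * (Real.sqrt (μ y))⁻¹ : ℝ) : ℂ) • f y) x))
        - (∫ x in Cyl R, hinner (vcurl v x)
            ((μ x : ℂ) • cross (gradC (fun y => (ε y * μ y)⁻¹) x) (f x)))
        + (∫ x in Cyl R, (((ε x)⁻¹ : ℝ) : ℂ)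
            * hinner (fun j => ∑ k, (Wm μ x j k : ℂ) * v x k) (f x))
        + surfInt R (fun x => hinner
            (fun j => (((ε x)⁻¹ * R⁻¹ * (if j = 2 then 0 else 1)
                - (2 * ε x * μ x)⁻¹ * dnu R μ x : ℝ) : ℂ) * v x j)
            (f x)) := by
  obtain ⟨ε', hε', hε'pos, hεε⟩ := hε.exists_pos_extension hεpos
  obtain ⟨μ', hμ', hμ'pos, hμμ⟩ := hμ.exists_pos_extension hμpos
  obtain ⟨v', hv', hvv, hv0⟩ := hv.exists_extension
  obtain ⟨f', hf', hff, -⟩ := hf.exists_extension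
  rw [eventually_nhdsSet_iff_forall] at hεε hμμ hvv hff
  replace hεε : ∀ x ∈ closure (Cyl R), ε' =ᶠ[nhds x] ε := hεε
  replace hμμ : ∀ x ∈ closure (Cyl R), μ' =ᶠ[nhds x] μ := hμμ
  replace hvv : ∀ x ∈ closure (Cyl R), v' =ᶠ[nhds x] v := hvv
  replace hff : ∀ x ∈ closure (Cyl R), f' =ᶠ[nhds x] f := hff
  have hm := (isOpen_cyl R).measurableSet
  have hC : Cyl R ⊆ closure (Cyl R) := subset_closure
  have hB := bCyl_subset_closure hR
  have key := integral_curl_curl_of_contDiff R hR ε' μ' v' f' hε' hμ' hε'pos hμ'pos hv' hf'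
    (by
      obtain ⟨T, hT, h⟩ := hvs
      exact ⟨T, hT, fun x hx => hv0 x (h x hx)⟩)
    (fun x hx => by
      rw [← hdiv x hx]
      refine vdiv_congr ?_
      filter_upwards [hμμ x (hC hx), hvv x (hC hx)] with y h1 h2
      rw [h1, h2])
    (fun x hx => by rw [(hvv x (hB hx)).eq_of_nhds, hvbc x hx])
    (fun x hx => by rw [(hff x (hB hx)).eq_of_nhds, hfbc x hx])
  refine Eq.trans (setIntegral_congr_fun hm fun x hx => ?_) (key.trans ?_)
  · have h1 := hεε x (hC hx)
    have h3 := hvv x (hC hx)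
    have h4 := hff x (hC hx)
    simp only [vcurl_congr h3, vcurl_congr h4, h1.eq_of_nhds]
  congr 1
  · congr 1
    · congr 1
      · refine setIntegral_congr_fun hm fun x hx => Finset.sum_congr rfl fun j _ => ?_
        have h1 := hεε x (hC hx)
        have h2 := hμμ x (hC hx)
        have h3 := hvv x (hC hx)
        have h4 := hff x (hC hx)
        congr 1
        · refine pdV_congr ?_ j
          filter_upwards [h2, h3] with y e2 e3
          rw [e2, e3]
        · refine pdV_congr ?_ j
          filter_upwards [h1, h2, h4] with y e1 e2 e4
          rw [e1, e2, e4]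
      · refine setIntegral_congr_fun hm fun x hx => ?_
        have h1 := hεε x (hC hx)
        have h2 := hμμ x (hC hx)
        have h3 := hvv x (hC hx)
        have h4 := hff x (hC hx)
        have h5 : (fun y => (ε' y * μ' y)⁻¹) =ᶠ[nhds x] fun y => (ε y * μ y)⁻¹ := by
          filter_upwards [h1, h2] with y e1 e2
          rw [e1, e2]
        simp only [vcurl_congr h3, gradC_congr h5, h2.eq_of_nhds, h4.eq_of_nhds]
    · refine setIntegral_congr_fun hm fun x hx => ?_
      have h1 := hεε x (hC hx)
      have h2 := hμμ x (hC hx)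
      have h3 := hvv x (hC hx)
      have h4 := hff x (hC hx)
      simp only [Wm_congr h2, h1.eq_of_nhds, h3.eq_of_nhds, h4.eq_of_nhds]
  · refine surfInt_congr fun θ t => ?_
    set x : V3 := ![R * Real.cos θ, R * Real.sin θ, t]
    have hx : x ∈ closure (Cyl R) := hB (by
      change (R * Real.cos θ) ^ 2 + (R * Real.sin θ) ^ 2 = R ^ 2
      linear_combination R ^ 2 * Real.cos_sq_add_sin_sq θ)
    have h1 := hεε x hx
    have h2 := hμμ x hx
    have h3 := hvv x hx
    have h4 := hff x hx
    simp only [dnu_congr h2, h1.eq_of_nhds, h2.eq_of_nhds, h3.eq_of_nhds, h4.eq_of_nhds]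

end
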